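/- Let P ⊂ [-1,1]² be a 1-unconditional convex polygon containing the points B = (0,1) and D = (-1,0), and let R = {(x,y,z) ∈ ℝ³ : (x, √(y²+z²)) ∈ P} be the body of revolution about the X-axis generated by P. Then the Mahler volume satisfies P(R) ≥ 4π²/3, with equality if and only if R is a cylinder (P = [-1,1]²) or a bicone (P = conv{(1,0), (-1,0), (0,1), (0,-1)}). -/

import Mathlib

open MeasureTheory Real Set

noncomputable def dot3 (x y : ℝ × ℝ × ℝ) : ℝ :=
  x.1 * y.1 + x.2.1 * y.2.1 + x.2.2 * y.2.2

def polar3 (K : Set (ℝ × ℝ × ℝ)) : Set (ℝ × ℝ × ℝ) :=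
  {x | ∀ y ∈ K, dot3 x y ≤ 1}

/-- The Mahler volume of a convex body in ℝ³. -/
noncomputable def mahler3 (K : Set (ℝ × ℝ × ℝ)) : ENNReal :=
  volume K * volume (polar3 K)

/-- The body of revolution about the X-axis generated by a planar set `D`. -/
def revolution (D : Set (ℝ × ℝ)) : Set (ℝ × ℝ × ℝ) :=
  {p : ℝ × ℝ × ℝ | ((p.1, Real.sqrt (p.2.1 ^ 2 + p.2.2 ^ 2)) : ℝ × ℝ) ∈ D}

/-- A closed convex set in the plane, symmetric in both coordinate axes, lying between the
diamond `|x| + |y| ≤ 1` and the square `[-1,1]²`. -/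
structure IsUnconditionalBody (D : Set (ℝ × ℝ)) : Prop where
  isClosed : IsClosed D
  convex : Convex ℝ D
  subset : D ⊆ {p : ℝ × ℝ | |p.1| ≤ 1 ∧ |p.2| ≤ 1}
  uncond : ∀ p ∈ D, ∀ ε δ : ℝ, (ε = 1 ∨ ε = -1) → (δ = 1 ∨ δ = -1) → (ε * p.1, δ * p.2) ∈ D
  top_mem : ((0 : ℝ), (1 : ℝ)) ∈ D
  left_mem : ((-1 : ℝ), (0 : ℝ)) ∈ D

/-- The polar of a planar set. -/
def polar2 (D : Set (ℝ × ℝ)) : Set (ℝ × ℝ) :=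
  {p | ∀ q ∈ D, p.1 * q.1 + p.2 * q.2 ≤ 1}

/-- The upper boundary function of a planar set; it vanishes off the projection of the set. -/
noncomputable def profile (D : Set (ℝ × ℝ)) (x : ℝ) : ℝ :=
  sSup {y | (x, y) ∈ D}

namespace IsUnconditionalBody

variable {D : Set (ℝ × ℝ)}

theorem right_mem (h : IsUnconditionalBody D) : ((1 : ℝ), (0 : ℝ)) ∈ D := by
  have := h.uncond _ h.left_mem (-1) 1 (by simp) (by simp)
  simpa using this

theorem combo_mem (h : IsUnconditionalBody D) {a b c d s t : ℝ} (hp : (a, b) ∈ D)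
    (hq : (c, d) ∈ D) (hs : 0 ≤ s) (ht : 0 ≤ t) (hst : s + t = 1) :
    (s * a + t * c, s * b + t * d) ∈ D := by
  have := h.convex hp hq hs ht hst
  simpa using this

theorem mk_mem_of_abs_le (h : IsUnconditionalBody D) {x y a b : ℝ} (hp : (a, b) ∈ D)
    (hx : |x| ≤ a) (hy : |y| ≤ b) : (x, y) ∈ D := by
  have neg_fst : ∀ {u v : ℝ}, (u, v) ∈ D → (-u, v) ∈ D := fun hm => by
    simpa using h.uncond _ hm (-1) 1 (by simp) (by simp)
  have neg_snd : ∀ {u v : ℝ}, (u, v) ∈ D → (u, -v) ∈ D := fun hm => by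
    simpa using h.uncond _ hm 1 (-1) (by simp) (by simp)
  have coef : ∀ {u c : ℝ}, |u| ≤ c → ∃ s t : ℝ, 0 ≤ s ∧ 0 ≤ t ∧ s + t = 1 ∧
      s * c + t * (-c) = u := by
    intro u c hu
    obtain ⟨h1, h2⟩ := abs_le.1 hu
    rcases (abs_nonneg u |>.trans hu).eq_or_lt with hc | hc
    · exact ⟨1, 0, by norm_num, le_rfl, by norm_num, by linarith⟩
    · refine ⟨(c + u) / (2 * c), (c - u) / (2 * c), ?_, ?_, ?_, ?_⟩
      · exact div_nonneg (by linarith) (by linarith)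
      · exact div_nonneg (by linarith) (by linarith)
      · field_simp; ring
      · field_simp; ring
  have hx' : ∀ {v : ℝ}, (a, v) ∈ D → (x, v) ∈ D := by
    intro v hv
    obtain ⟨s, t, hs, ht, hst, he⟩ := coef hx
    have := h.combo_mem hv (neg_fst hv) hs ht hst
    rwa [he, ← add_mul, hst, one_mul] at this
  obtain ⟨s, t, hs, ht, hst, he⟩ := coef hy
  have := h.combo_mem hp (neg_snd hp) hs ht hst
  rw [he, ← add_mul, hst, one_mul] at this
  exact hx' this

theorem abs_mem_iff (h : IsUnconditionalBody D) {x y : ℝ} : (|x|, |y|) ∈ D ↔ (x, y) ∈ D := by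
  refine ⟨fun hp => h.mk_mem_of_abs_le hp le_rfl le_rfl, fun hp => ?_⟩
  obtain ⟨ε, hε, hx⟩ : ∃ ε : ℝ, (ε = 1 ∨ ε = -1) ∧ |x| = ε * x := by
    rcases abs_choice x with e | e
    · exact ⟨1, by simp, by simp [e]⟩
    · exact ⟨-1, by simp, by simp [e]⟩
  obtain ⟨δ, hδ, hy⟩ : ∃ δ : ℝ, (δ = 1 ∨ δ = -1) ∧ |y| = δ * y := by
    rcases abs_choice y with e | e
    · exact ⟨1, by simp, by simp [e]⟩
    · exact ⟨-1, by simp, by simp [e]⟩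
  rw [hx, hy]
  exact h.uncond _ hp ε δ hε hδ

theorem bddAbove_slice (h : IsUnconditionalBody D) (x : ℝ) : BddAbove {y | (x, y) ∈ D} :=
  ⟨1, fun _ hy => (abs_le.1 (h.subset hy).2).2⟩

theorem le_profile (h : IsUnconditionalBody D) {x y : ℝ} (hp : (x, y) ∈ D) : y ≤ profile D x :=
  le_csSup (h.bddAbove_slice x) hp

theorem profile_mem (h : IsUnconditionalBody D) {x : ℝ} (hx : x ∈ Icc (0 : ℝ) 1) :
    (x, profile D x) ∈ D := by
  have hc : IsClosed {y | (x, y) ∈ D} := h.isClosed.preimage (by fun_prop : Continuous fun y => (x, y))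
  have hne : {y | (x, y) ∈ D}.Nonempty :=
    ⟨0, h.mk_mem_of_abs_le h.right_mem (by rw [abs_of_nonneg hx.1]; exact hx.2) (by simp)⟩
  exact hc.csSup_mem hne (h.bddAbove_slice x)

theorem one_sub_le_profile (h : IsUnconditionalBody D) {x : ℝ} (hx : x ∈ Icc (0 : ℝ) 1) :
    1 - x ≤ profile D x := by
  have := h.combo_mem h.top_mem h.right_mem (sub_nonneg.2 hx.2) hx.1 (by ring)
  exact h.le_profile (by simpa using this)

theorem profile_le_one (h : IsUnconditionalBody D) {x : ℝ} (hx : x ∈ Icc (0 : ℝ) 1) :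
    profile D x ≤ 1 :=
  (abs_le.1 (h.subset (h.profile_mem hx)).2).2

theorem profile_nonneg (h : IsUnconditionalBody D) {x : ℝ} (hx : x ∈ Icc (0 : ℝ) 1) :
    0 ≤ profile D x :=
  (sub_nonneg.2 hx.2).trans (h.one_sub_le_profile hx)

theorem profile_eq_zero (h : IsUnconditionalBody D) {x : ℝ} (hx : 1 < x) : profile D x = 0 := by
  have : {y | (x, y) ∈ D} = ∅ := by
    ext y
    simp only [mem_ofPred_eq, mem_empty_iff_false, iff_false]
    intro hy
    have := (abs_le.1 (h.subset hy).1).2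
    simp only at this
    linarith
  rw [profile, this, Real.sSup_empty]

theorem antitoneOn_profile (h : IsUnconditionalBody D) : AntitoneOn (profile D) (Icc 0 1) := by
  intro x hx y hy hxy
  exact h.le_profile (h.mk_mem_of_abs_le (h.profile_mem hy) (by rwa [abs_of_nonneg hx.1])
    (abs_of_nonneg (h.profile_nonneg hy)).le)

theorem antitoneOn_profile_sq (h : IsUnconditionalBody D) :
    AntitoneOn (fun x => profile D x ^ 2) (Icc 0 1) := by
  intro x hx y hy hxy
  exact pow_le_pow_left₀ (h.profile_nonneg hy) (h.antitoneOn_profile hx hy hxy) 2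

theorem intervalIntegrable_profile (h : IsUnconditionalBody D) :
    IntervalIntegrable (profile D) volume 0 1 :=
  AntitoneOn.intervalIntegrable (by simpa using h.antitoneOn_profile)

theorem intervalIntegrable_profile_sq (h : IsUnconditionalBody D) :
    IntervalIntegrable (fun x => profile D x ^ 2) volume 0 1 :=
  AntitoneOn.intervalIntegrable (by simpa using h.antitoneOn_profile_sq)

theorem mem_iff (h : IsUnconditionalBody D) {x y : ℝ} :
    (x, y) ∈ D ↔ |x| ≤ 1 ∧ |y| ≤ profile D |x| := by
  constructor
  · intro hp
    exact ⟨(h.subset hp).1, h.le_profile (h.abs_mem_iff.2 hp)⟩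
  · rintro ⟨hx, hy⟩
    exact h.mk_mem_of_abs_le (h.profile_mem ⟨abs_nonneg x, hx⟩) le_rfl hy

theorem polar2 (h : IsUnconditionalBody D) : IsUnconditionalBody (polar2 D) where
  isClosed := by
    simp only [_root_.polar2, ofPred_forall]
    exact isClosed_biInter fun q _ => isClosed_le (by fun_prop) continuous_const
  convex := by
    intro p hp q hq s t hs ht hst r hr
    have h1 := mul_le_mul_of_nonneg_left (hp r hr) hs
    have h2 := mul_le_mul_of_nonneg_left (hq r hr) ht
    simp only [Prod.fst_add, Prod.snd_add, Prod.smul_fst, Prod.smul_snd, smul_eq_mul]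
    linarith
  subset := by
    intro p hp
    have h1 := hp _ h.left_mem
    have h2 := hp _ h.right_mem
    have h3 := hp _ h.top_mem
    have h4 := hp _ (h.mk_mem_of_abs_le (x := 0) (y := -1) h.top_mem (by simp) (by simp))
    simp only at h1 h2 h3 h4
    exact ⟨abs_le.2 ⟨by linarith, by linarith⟩, abs_le.2 ⟨by linarith, by linarith⟩⟩
  uncond := by
    intro p hp ε δ hε hδ q hq
    have := hp _ (h.uncond q hq ε δ hε hδ)
    simp only at this ⊢
    linarith
  top_mem := by
    intro q hq
    have := (abs_le.1 (h.subset hq).2).2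
    simpa using this
  left_mem := by
    intro q hq
    have := (abs_le.1 (h.subset hq).1).1
    simp only
    linarith

theorem mem_polar2_of_nonneg (h : IsUnconditionalBody D) {c d : ℝ} (hc : 0 ≤ c) (hd : 0 ≤ d)
    (hcd : ∀ a b : ℝ, a ∈ Icc (0 : ℝ) 1 → (a, b) ∈ D → c * a + d * b ≤ 1) :
    (c, d) ∈ _root_.polar2 D := by
  rintro ⟨x, y⟩ hp
  have := hcd |x| |y| ⟨abs_nonneg x, (h.subset hp).1⟩ (h.abs_mem_iff.2 hp)
  have h1 := mul_le_mul_of_nonneg_left (le_abs_self x) hc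
  have h2 := mul_le_mul_of_nonneg_left (le_abs_self y) hd
  simp only
  linarith

theorem polar2_polar2 (h : IsUnconditionalBody D) : _root_.polar2 (_root_.polar2 D) = D := by
  apply Subset.antisymm
  · intro p hp
    by_contra hpD
    obtain ⟨φ, u, hu, hup⟩ := geometric_hahn_banach_closed_point h.convex h.isClosed hpD
    have hφ : ∀ q : ℝ × ℝ, φ q = φ (1, 0) * q.1 + φ (0, 1) * q.2 := by
      intro q
      have : q = q.1 • ((1 : ℝ), (0 : ℝ)) + q.2 • ((0 : ℝ), (1 : ℝ)) := by ext <;> simp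
      conv_lhs => rw [this]
      simp only [map_add, map_smul, smul_eq_mul]
      ring
    have hu0 : 0 < u := by
      have := hu (0, 0) (h.mk_mem_of_abs_le h.top_mem (by simp) (by simp))
      rw [hφ] at this
      simpa using this
    have hm : (φ (1, 0) / u, φ (0, 1) / u) ∈ _root_.polar2 D := by
      intro q hq
      have := hu q hq
      rw [hφ] at this
      simp only
      rw [div_mul_eq_mul_div, div_mul_eq_mul_div, ← add_div, div_le_one hu0]
      exact this.le
    have := hp _ hm
    simp only at this
    rw [mul_div_assoc', mul_div_assoc', ← add_div, div_le_one hu0] at this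
    rw [hφ] at hup
    linarith
  · intro p hp q hq
    have := hq p hp
    linarith

end IsUnconditionalBody

/-- The second moment `∫₀¹ f²` of the profile; the body of revolution has volume `2π` times it. -/
noncomputable def profileSqIntegral (D : Set (ℝ × ℝ)) : ℝ :=
  ∫ x in (0 : ℝ)..1, profile D x ^ 2

/-- The area of the part of the set lying in the first quadrant. -/
noncomputable def profileIntegral (D : Set (ℝ × ℝ)) : ℝ :=
  ∫ x in (0 : ℝ)..1, profile D x

theorem AntitoneOn.integral_comp_homothety_le {g : ℝ → ℝ} (hg : AntitoneOn g (Icc 0 1))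
    (hg0 : ∀ x ∈ Icc (0 : ℝ) 1, 0 ≤ g x) {a t : ℝ} (ha : a ∈ Icc (0 : ℝ) 1)
    (ht : t ∈ Ioo (0 : ℝ) 1) :
    (1 - t) * (∫ x in (0 : ℝ)..1, g ((1 - t) * x + t * a)) + t * a * g (t * a) ≤
      ∫ x in (0 : ℝ)..1, g x := by
  obtain ⟨ha0, ha1⟩ := ha
  obtain ⟨ht0, ht1⟩ := ht
  have hta0 : 0 ≤ t * a := mul_nonneg ht0.le ha0
  have hta1 : t * a ≤ t := mul_le_of_le_one_right ht0.le ha1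
  have hint : ∀ {u v : ℝ}, 0 ≤ u → u ≤ v → v ≤ 1 → IntervalIntegrable g volume u v :=
    fun hu huv hv => AntitoneOn.intervalIntegrable
      (hg.mono (by rw [uIcc_of_le huv]; exact Icc_subset_Icc hu hv))
  rw [intervalIntegral.integral_comp_mul_add g (by linarith : (1 - t) ≠ 0), smul_eq_mul,
    mul_inv_cancel_left₀ (by linarith)]
  have e1 : (1 - t) * 0 + t * a = t * a := by ring
  have e2 : (1 - t) * 1 + t * a = 1 - t + t * a := by ring
  rw [e1, e2, ← intervalIntegral.integral_add_adjacent_intervals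
    (hint le_rfl hta0 (by linarith)) (hint hta0 (by linarith) le_rfl),
    ← intervalIntegral.integral_add_adjacent_intervals
    (hint hta0 (by linarith : t * a ≤ 1 - t + t * a) (by linarith))
    (hint (by linarith) (by linarith : 1 - t + t * a ≤ 1) le_rfl)]
  have h1 : 0 ≤ ∫ x in (1 - t + t * a)..1, g x :=
    intervalIntegral.integral_nonneg (by linarith)
      fun x hx => hg0 x ⟨by linarith [hx.1], hx.2⟩
  have h2 : (∫ _ in (0 : ℝ)..(t * a), g (t * a)) ≤ ∫ x in (0 : ℝ)..(t * a), g x :=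
    intervalIntegral.integral_mono_on hta0 (by simp) (hint le_rfl hta0 (by linarith))
      fun x hx => hg ⟨hx.1, by linarith [hx.2]⟩ ⟨hta0, by linarith⟩ hx.2
  rw [intervalIntegral.integral_const, smul_eq_mul, sub_zero] at h2
  linarith

theorem le_at_zero_of_forall_Ioo {L R : ℝ → ℝ} (hL : Continuous L) (hR : Continuous R)
    (h : ∀ t ∈ Ioo (0 : ℝ) 1, L t ≤ R t) : L 0 ≤ R 0 := by
  have h0 : (0 : ℝ) ∈ closure (Ioo (0 : ℝ) 1) := by
    rw [closure_Ioo (by norm_num)]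
    simp
  exact closure_minimal (t := {t | L t ≤ R t}) h (isClosed_le hL hR) h0

namespace IsUnconditionalBody

variable {D : Set (ℝ × ℝ)}

theorem homothety_mem {a x t : ℝ} (ha : a ∈ Icc (0 : ℝ) 1) (hx : x ∈ Icc (0 : ℝ) 1)
    (ht : t ∈ Ioo (0 : ℝ) 1) : (1 - t) * x + t * a ∈ Icc (0 : ℝ) 1 := by
  obtain ⟨ha0, ha1⟩ := ha
  obtain ⟨hx0, hx1⟩ := hx
  obtain ⟨ht0, ht1⟩ := ht
  constructor <;> nlinarith

theorem intervalIntegrable_homothety {g : ℝ → ℝ} (hg : AntitoneOn g (Icc 0 1)) {a t : ℝ}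
    (ha : a ∈ Icc (0 : ℝ) 1) (ht : t ∈ Ioo (0 : ℝ) 1) :
    IntervalIntegrable (fun x => g ((1 - t) * x + t * a)) volume 0 1 := by
  apply AntitoneOn.intervalIntegrable
  rw [uIcc_of_le zero_le_one]
  intro x hx y hy hxy
  refine hg (homothety_mem ha hx ht) (homothety_mem ha hy ht) ?_
  have := mul_le_mul_of_nonneg_left hxy (sub_nonneg.2 ht.2.le)
  linarith

theorem profile_homothety (h : IsUnconditionalBody D) {a b x t : ℝ} (hp : (a, b) ∈ D)
    (hx : x ∈ Icc (0 : ℝ) 1) (ht : t ∈ Ioo (0 : ℝ) 1) :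
    (1 - t) * profile D x + t * b ≤ profile D ((1 - t) * x + t * a) :=
  h.le_profile (h.combo_mem (h.profile_mem hx) hp (sub_nonneg.2 ht.2.le) ht.1.le (by ring))

theorem add_le_two_mul_profileIntegral (h : IsUnconditionalBody D) {a b : ℝ}
    (ha : a ∈ Icc (0 : ℝ) 1) (hp : (a, b) ∈ D) : a + b ≤ 2 * profileIntegral D := by
  have key : ∀ t ∈ Ioo (0 : ℝ) 1,
      (1 - t) * b + a * (1 - t * a) ≤ (2 - t) * profileIntegral D := by
    intro t ht
    have h1 := h.antitoneOn_profile.integral_comp_homothety_le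
      (fun x hx => h.profile_nonneg hx) ha ht
    have h2 : (∫ x in (0 : ℝ)..1, ((1 - t) * profile D x + t * b)) ≤
        ∫ x in (0 : ℝ)..1, profile D ((1 - t) * x + t * a) :=
      intervalIntegral.integral_mono_on zero_le_one
        ((h.intervalIntegrable_profile.const_mul _).add (by simp))
        (intervalIntegrable_homothety h.antitoneOn_profile ha ht)
        fun x hx => h.profile_homothety hp hx ht
    rw [intervalIntegral.integral_add (h.intervalIntegrable_profile.const_mul _) (by simp),
      intervalIntegral.integral_const_mul, intervalIntegral.integral_const, smul_eq_mul] at h2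
    have h3 : 1 - t * a ≤ profile D (t * a) :=
      h.one_sub_le_profile ⟨mul_nonneg ht.1.le ha.1, mul_le_one₀ ht.2.le ha.1 ha.2⟩
    have h4 := mul_le_mul_of_nonneg_left h3 (mul_nonneg ht.1.le ha.1)
    have h5 := mul_le_mul_of_nonneg_left h2 (sub_nonneg.2 ht.2.le)
    rw [← profileIntegral] at h1 h5
    have h6 : t * ((1 - t) * b + a * (1 - t * a)) ≤ t * ((2 - t) * profileIntegral D) := by
      linarith
    exact le_of_mul_le_mul_left h6 ht.1
  have := le_at_zero_of_forall_Ioo (by fun_prop) (by fun_prop) key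
  linarith

theorem add_le_three_mul_profileSqIntegral (h : IsUnconditionalBody D) {a b : ℝ}
    (ha : a ∈ Icc (0 : ℝ) 1) (hb : 0 ≤ b) (hp : (a, b) ∈ D) :
    a + 2 * profileIntegral D * b ≤ 3 * profileSqIntegral D := by
  have key : ∀ t ∈ Ioo (0 : ℝ) 1,
      2 * (1 - t) ^ 2 * b * profileIntegral D + a * (1 - t * a) ^ 2 ≤
        (3 - 3 * t + t ^ 2) * profileSqIntegral D := by
    intro t ht
    have ht' : 0 ≤ 1 - t := sub_nonneg.2 ht.2.le
    have h1 := h.antitoneOn_profile_sq.integral_comp_homothety_le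
      (fun x _ => sq_nonneg _) ha ht
    have i1 := h.intervalIntegrable_profile_sq.const_mul ((1 - t) ^ 2)
    have i2 := h.intervalIntegrable_profile.const_mul (2 * t * (1 - t) * b)
    have h2 : (∫ x in (0 : ℝ)..1,
        ((1 - t) ^ 2 * profile D x ^ 2 + 2 * t * (1 - t) * b * profile D x)) ≤
        ∫ x in (0 : ℝ)..1, profile D ((1 - t) * x + t * a) ^ 2 := by
      refine intervalIntegral.integral_mono_on zero_le_one (i1.add i2)
        (intervalIntegrable_homothety h.antitoneOn_profile_sq ha ht) fun x hx => ?_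
      have h0 : 0 ≤ (1 - t) * profile D x + t * b :=
        add_nonneg (mul_nonneg ht' (h.profile_nonneg hx)) (mul_nonneg ht.1.le hb)
      have := pow_le_pow_left₀ h0 (h.profile_homothety hp hx ht) 2
      nlinarith [sq_nonneg (t * b)]
    rw [intervalIntegral.integral_add i1 i2,
      intervalIntegral.integral_const_mul, intervalIntegral.integral_const_mul] at h2
    have hta : t * a ≤ 1 := mul_le_one₀ ht.2.le ha.1 ha.2
    have h3 : (1 - t * a) ^ 2 ≤ profile D (t * a) ^ 2 :=
      pow_le_pow_left₀ (sub_nonneg.2 hta)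
        (h.one_sub_le_profile ⟨mul_nonneg ht.1.le ha.1, hta⟩) 2
    have h4 := mul_le_mul_of_nonneg_left h3 (mul_nonneg ht.1.le ha.1)
    have h5 := mul_le_mul_of_nonneg_left h2 ht'
    rw [← profileIntegral, ← profileSqIntegral] at h5
    rw [← profileSqIntegral] at h1
    have h6 : t * (2 * (1 - t) ^ 2 * b * profileIntegral D + a * (1 - t * a) ^ 2) ≤
        t * ((3 - 3 * t + t ^ 2) * profileSqIntegral D) := by
      linarith
    exact le_of_mul_le_mul_left h6 ht.1
  have := le_at_zero_of_forall_Ioo (by fun_prop) (by fun_prop) key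
  linarith

theorem profileIntegral_le_one (h : IsUnconditionalBody D) : profileIntegral D ≤ 1 := by
  have := intervalIntegral.integral_mono_on zero_le_one h.intervalIntegrable_profile
    (intervalIntegrable_const (c := (1 : ℝ))) fun x hx => h.profile_le_one hx
  simpa [profileIntegral] using this

theorem half_le_profileIntegral (h : IsUnconditionalBody D) : 1 / 2 ≤ profileIntegral D := by
  have := h.add_le_two_mul_profileIntegral (by simp) h.top_mem
  linarith

theorem third_le_profileSqIntegral (h : IsUnconditionalBody D) : 1 / 3 ≤ profileSqIntegral D := by
  have := h.add_le_three_mul_profileSqIntegral (by simp) le_rfl h.right_mem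
  linarith

theorem one_le_two_mul_profileIntegral_mul (h : IsUnconditionalBody D) :
    1 ≤ 2 * (profileIntegral D * profileIntegral (_root_.polar2 D)) := by
  set I := profileIntegral D with hI
  have hI0 : 0 < I := by linarith [h.half_le_profileIntegral]
  have hm : (1 / (2 * I), 1 / (2 * I)) ∈ _root_.polar2 D := by
    refine h.mem_polar2_of_nonneg (by positivity) (by positivity) fun a b ha hp => ?_
    rw [← mul_add, one_div_mul_eq_div, div_le_one (by positivity)]
    exact h.add_le_two_mul_profileIntegral ha hp
  have := h.polar2.add_le_two_mul_profileIntegral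
    ⟨by positivity, (abs_le.1 (h.polar2.subset hm).1).2⟩ hm
  rw [← mul_two, one_div_mul_eq_div, div_le_iff₀ (by positivity)] at this
  linarith

theorem one_add_le_nine_mul_profileSqIntegral_mul (h : IsUnconditionalBody D) :
    1 + 4 * (profileIntegral D * profileIntegral (_root_.polar2 D)) ≤
      9 * (profileSqIntegral D * profileSqIntegral (_root_.polar2 D)) := by
  set I := profileIntegral D with hI
  set A := profileSqIntegral D with hA
  have hI0 : 0 < I := by linarith [h.half_le_profileIntegral]
  have hA0 : 0 < A := by linarith [h.third_le_profileSqIntegral]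
  have hm : (1 / (3 * A), 2 * I / (3 * A)) ∈ _root_.polar2 D := by
    refine h.mem_polar2_of_nonneg (by positivity) (by positivity) fun a b ha hp => ?_
    have hp' : (a, |b|) ∈ D := h.mk_mem_of_abs_le (h.abs_mem_iff.2 hp) (by simp) (by simp)
    have h1 := h.add_le_three_mul_profileSqIntegral ha (abs_nonneg b) hp'
    have h2 := mul_le_mul_of_nonneg_left (le_abs_self b) hI0.le
    rw [one_div_mul_eq_div, div_mul_eq_mul_div, ← add_div, div_le_one (by positivity)]
    linarith
  have := h.polar2.add_le_three_mul_profileSqIntegral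
    ⟨by positivity, (abs_le.1 (h.polar2.subset hm).1).2⟩ (by positivity) hm
  rw [mul_div_assoc', ← add_div, div_le_iff₀ (by positivity)] at this
  linarith

/-- If `(s, s)` with `s = ∫₀¹ f` lies in the body, the body is a quadrilateral in the first
quadrant, which gives the reverse of the inequality at that point. -/
theorem three_mul_profileSqIntegral_le (h : IsUnconditionalBody D)
    (hm : (profileIntegral D, profileIntegral D) ∈ D) :
    3 * profileSqIntegral D ≤ profileIntegral D + 2 * profileIntegral D ^ 2 := by
  set s := profileIntegral D with hs
  have hs0 : 0 < s := by linarith [h.half_le_profileIntegral]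
  have hs1 : s ≤ 1 := h.profileIntegral_le_one
  have i1 := h.intervalIntegrable_profile.const_mul 2
  have isq : IntervalIntegrable (fun x => (1 - profile D x) ^ 2) volume 0 1 := by
    have := (h.intervalIntegrable_profile_sq.sub i1).add (intervalIntegrable_const (c := (1 : ℝ)))
    refine this.congr fun x _ => ?_
    ring
  have hA : profileSqIntegral D = 2 * s - 1 + ∫ x in (0 : ℝ)..1, (1 - profile D x) ^ 2 := by
    have e : ∀ x, profile D x ^ 2 = (2 * profile D x - 1) + (1 - profile D x) ^ 2 := fun x => by ring
    simp_rw [profileSqIntegral, e]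
    rw [intervalIntegral.integral_add (i1.sub intervalIntegrable_const) isq,
      intervalIntegral.integral_sub i1 intervalIntegrable_const,
      intervalIntegral.integral_const_mul]
    simp [hs, profileIntegral]
  have isq' : ∀ {u v : ℝ}, 0 ≤ u → u ≤ v → v ≤ 1 →
      IntervalIntegrable (fun x => (1 - profile D x) ^ 2) volume u v := fun hu huv hv =>
    isq.mono_set (by
      rw [uIcc_of_le huv, uIcc_of_le zero_le_one]
      exact Icc_subset_Icc hu hv)
  have hl : (∫ x in (0 : ℝ)..s, (1 - profile D x) ^ 2) ≤ s * (1 - s) ^ 2 / 3 := by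
    have h1 : (∫ x in (0 : ℝ)..s, (1 - profile D x) ^ 2) ≤
        ∫ x in (0 : ℝ)..s, ((1 - s) / s) ^ 2 * x ^ 2 := by
      refine intervalIntegral.integral_mono_on hs0.le (isq' le_rfl hs0.le hs1)
        (Continuous.intervalIntegrable (by fun_prop) _ _) fun x hx => ?_
      have hxs : x / s ≤ 1 := (div_le_one hs0).2 hx.2
      have hc := h.le_profile (h.combo_mem h.top_mem hm (sub_nonneg.2 hxs)
        (div_nonneg hx.1 hs0.le) (by ring))
      have e : (1 - x / s) * 0 + x / s * s = x := by field_simp; ring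
      rw [e] at hc
      rw [← mul_pow]
      refine pow_le_pow_left₀ (sub_nonneg.2 (h.profile_le_one ⟨hx.1, hx.2.trans hs1⟩)) ?_ 2
      have e2 : (1 - s) / s * x = x / s - x / s * s := by field_simp
      linarith
    refine h1.trans_eq ?_
    rw [intervalIntegral.integral_const_mul, integral_pow]
    field_simp
    norm_num
    ring
  have hr : (∫ x in s..1, (1 - profile D x) ^ 2) ≤ (1 - s) * (3 - 3 * s + s ^ 2) / 3 := by
    rcases hs1.eq_or_lt with hs1' | hs1'
    · simp [hs1']
    have hu : 0 < 1 - s := sub_pos.2 hs1'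
    set r := s / (1 - s) with hr
    have hru : r * (1 - s) = s := div_mul_cancel₀ s hu.ne'
    have h1 : (∫ x in s..1, (1 - profile D x) ^ 2) ≤
        ∫ x in s..1, (fun y => 1 - 2 * r * y + r ^ 2 * y ^ 2) (1 - x) := by
      refine intervalIntegral.integral_mono_on hs1 (isq' hs0.le hs1 le_rfl)
        (Continuous.intervalIntegrable (by fun_prop) _ _) fun x hx => ?_
      have hx1 : (1 - x) / (1 - s) ≤ 1 := (div_le_one hu).2 (by linarith [hx.1])
      have hc := h.le_profile (h.combo_mem hm h.right_mem
        (div_nonneg (sub_nonneg.2 hx.2) hu.le) (sub_nonneg.2 hx1) (by ring))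
      have e : (1 - x) / (1 - s) * s + (1 - (1 - x) / (1 - s)) * 1 = x := by field_simp; ring
      rw [e] at hc
      have e2 : 1 - 2 * r * (1 - x) + r ^ 2 * (1 - x) ^ 2 = (1 - r * (1 - x)) ^ 2 := by ring
      simp only [e2]
      have hx0 : x ∈ Icc (0 : ℝ) 1 := ⟨hs0.le.trans hx.1, hx.2⟩
      refine pow_le_pow_left₀ (sub_nonneg.2 (h.profile_le_one hx0)) ?_ 2
      have e3 : r * (1 - x) = (1 - x) / (1 - s) * s := by rw [hr]; ring
      linarith
    refine h1.trans_eq ?_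
    rw [intervalIntegral.integral_comp_sub_left
        (fun y => 1 - 2 * r * y + r ^ 2 * y ^ 2) 1, sub_self,
      intervalIntegral.integral_add (Continuous.intervalIntegrable (by fun_prop) _ _)
        (Continuous.intervalIntegrable (by fun_prop) _ _),
      intervalIntegral.integral_sub (Continuous.intervalIntegrable (by fun_prop) _ _)
        (Continuous.intervalIntegrable (by fun_prop) _ _),
      intervalIntegral.integral_const_mul, intervalIntegral.integral_const_mul, integral_pow,
      integral_id, intervalIntegral.integral_const, smul_eq_mul]
    have e4 : r ^ 2 * (1 - s) ^ 3 = s ^ 2 * (1 - s) := by linear_combination (r * (1 - s) + s) * (1 - s) * hru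
    have e5 : r * (1 - s) ^ 2 = s * (1 - s) := by rw [pow_two, ← mul_assoc, hru]
    norm_num
    linear_combination e4 / 3 - e5
  rw [hA, ← intervalIntegral.integral_add_adjacent_intervals (isq' le_rfl hs0.le hs1)
    (isq' hs0.le hs1 le_rfl)]
  nlinarith

end IsUnconditionalBody

theorem volume_sqrt_sq_add_sq_le {r : ℝ} (hr : 0 ≤ r) :
    volume {w : ℝ × ℝ | √(w.1 ^ 2 + w.2 ^ 2) ≤ r} = ENNReal.ofReal (π * r ^ 2) := by
  have e : Complex.measurableEquivRealProd ⁻¹' {w : ℝ × ℝ | √(w.1 ^ 2 + w.2 ^ 2) ≤ r} =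
      Metric.closedBall 0 r := by
    ext z
    simp [Complex.measurableEquivRealProd_apply, Complex.norm_eq_sqrt_sq_add_sq]
  rw [← Complex.volume_preserving_equiv_real_prod.measure_preimage_equiv, e,
    Complex.volume_closedBall, mul_comm π, ENNReal.ofReal_mul (by positivity),
    ENNReal.ofReal_pow hr]
  congr 1
  exact (ENNReal.ofReal_coe_nnreal (p := NNReal.pi)).symm

namespace IsUnconditionalBody

variable {D : Set (ℝ × ℝ)}

theorem volume_slice_revolution (h : IsUnconditionalBody D) (x : ℝ) :
    volume (Prod.mk x ⁻¹' revolution D) = ENNReal.ofReal (π * profile D |x| ^ 2) := by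
  rcases le_or_gt |x| 1 with hx | hx
  · rw [← volume_sqrt_sq_add_sq_le (h.profile_nonneg ⟨abs_nonneg x, hx⟩)]
    congr 1
    ext w
    simp [revolution, h.mem_iff, hx, abs_of_nonneg (Real.sqrt_nonneg _)]
  · have e : Prod.mk x ⁻¹' revolution D = ∅ := by
      ext w
      simp [revolution, h.mem_iff, not_le.2 hx]
    rw [e, h.profile_eq_zero hx]
    simp

theorem integrable_profile_abs_sq (h : IsUnconditionalBody D) :
    Integrable (fun x => profile D |x| ^ 2) := by
  have h1 : IntervalIntegrable (fun x => profile D |x| ^ 2) volume 0 1 := by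
    refine h.intervalIntegrable_profile_sq.congr fun x hx => ?_
    rw [uIoc_of_le zero_le_one] at hx
    simp only [abs_of_pos hx.1]
  have h2 : IntervalIntegrable (fun x => profile D |x| ^ 2) volume (-1) 0 := by
    have := (IntervalIntegrable.iff_comp_neg).1 h1
    simpa using this.symm
  have h3 : IntegrableOn (fun x => profile D |x| ^ 2) (Ioc (-1) 1) :=
    (intervalIntegrable_iff_integrableOn_Ioc_of_le (by norm_num)).1 (h2.trans h1)
  refine (integrableOn_Icc_iff_integrableOn_Ioc (by simp) |>.2 h3).integrable_of_forall_notMem_eq_zero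
    fun x hx => ?_
  have hx' : 1 < |x| := not_le.1 fun hle => hx (abs_le.1 hle)
  simp [h.profile_eq_zero hx']

theorem integral_profile_abs_sq (h : IsUnconditionalBody D) :
    ∫ x, profile D |x| ^ 2 = 2 * profileSqIntegral D := by
  rw [integral_comp_abs (f := fun x => profile D x ^ 2), profileSqIntegral,
    intervalIntegral.integral_of_le zero_le_one]
  congr 1
  refine (setIntegral_eq_of_subset_of_forall_sdiff_eq_zero measurableSet_Ioi
    (fun x hx => hx.1) fun x hx => ?_)
  have : 1 < x := by
    by_contra hx'
    exact hx.2 ⟨hx.1, not_lt.1 hx'⟩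
  simp [h.profile_eq_zero this]

theorem volume_revolution (h : IsUnconditionalBody D) :
    volume (revolution D) = ENNReal.ofReal (2 * π * profileSqIntegral D) := by
  have hm : MeasurableSet (revolution D) :=
    (h.isClosed.preimage (f := fun p : ℝ × ℝ × ℝ => (p.1, √(p.2.1 ^ 2 + p.2.2 ^ 2)))
      (by fun_prop)).measurableSet
  rw [Measure.volume_eq_prod, Measure.prod_apply hm]
  simp_rw [h.volume_slice_revolution]
  rw [← ofReal_integral_eq_lintegral_ofReal (h.integrable_profile_abs_sq.const_mul π)
    (Filter.Eventually.of_forall fun x => by positivity), integral_const_mul,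
    h.integral_profile_abs_sq]
  congr 1
  ring

theorem polar3_revolution (h : IsUnconditionalBody D) :
    polar3 (revolution D) = revolution (_root_.polar2 D) := by
  ext ⟨u, v₁, v₂⟩
  constructor
  · rintro hp ⟨x, y⟩ hq
    have hn : 0 ≤ v₁ ^ 2 + v₂ ^ 2 := by positivity
    have hy : (x, |y|) ∈ D := h.abs_mem_iff.1 (by simpa using h.abs_mem_iff.2 hq)
    rcases hn.eq_or_lt with hv | hv
    · have h1 : v₁ = 0 := by nlinarith
      have h2 : v₂ = 0 := by nlinarith
      have := hp (x, y, 0) (by simpa [revolution, Real.sqrt_sq_eq_abs] using hy)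
      simpa [dot3, h1, h2] using this
    · set n := √(v₁ ^ 2 + v₂ ^ 2) with hndef
      have hn0 : 0 < n := Real.sqrt_pos.2 hv
      have hnn : n ^ 2 = v₁ ^ 2 + v₂ ^ 2 := Real.sq_sqrt hn
      have e : (y * v₁ / n) ^ 2 + (y * v₂ / n) ^ 2 = y ^ 2 := by
        field_simp
        linear_combination -y ^ 2 * hnn
      have := hp (x, y * v₁ / n, y * v₂ / n) (by
        simp only [revolution, mem_ofPred_eq, e, Real.sqrt_sq_eq_abs]
        exact hy)
      have e2 : v₁ * (y * v₁ / n) + v₂ * (y * v₂ / n) = n * y := by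
        field_simp
        linear_combination -y * hnn
      simp only [dot3] at this
      simp only
      linarith
  · rintro hp ⟨x, w₁, w₂⟩ hq
    have h1 := hp _ hq
    have h2 : v₁ * w₁ + v₂ * w₂ ≤ √(v₁ ^ 2 + v₂ ^ 2) * √(w₁ ^ 2 + w₂ ^ 2) := by
      rw [← Real.sqrt_mul (by positivity)]
      exact Real.le_sqrt_of_sq_le (by nlinarith [sq_nonneg (v₁ * w₂ - v₂ * w₁)])
    simp only at h1
    simp only [dot3]
    linarith

theorem mahler3_revolution (h : IsUnconditionalBody D) :
    mahler3 (revolution D) = ENNReal.ofReal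
      (4 * π ^ 2 * (profileSqIntegral D * profileSqIntegral (_root_.polar2 D))) := by
  have := h.third_le_profileSqIntegral
  rw [mahler3, h.polar3_revolution, h.volume_revolution, h.polar2.volume_revolution,
    ← ENNReal.ofReal_mul (by positivity)]
  congr 1
  ring

theorem third_le_profileSqIntegral_mul (h : IsUnconditionalBody D) :
    1 / 3 ≤ profileSqIntegral D * profileSqIntegral (_root_.polar2 D) := by
  linarith [h.one_le_two_mul_profileIntegral_mul, h.one_add_le_nine_mul_profileSqIntegral_mul]

theorem eq_square_iff (h : IsUnconditionalBody D) :
    D = {p : ℝ × ℝ | |p.1| ≤ 1 ∧ |p.2| ≤ 1} ↔ ((1 : ℝ), (1 : ℝ)) ∈ D := by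
  constructor
  · rintro rfl
    simp
  · intro hm
    exact h.subset.antisymm fun p hp => h.mk_mem_of_abs_le hm hp.1 hp.2

theorem eq_diamond_iff (h : IsUnconditionalBody D) :
    D = convexHull ℝ {((1 : ℝ), (0 : ℝ)), (-1, 0), (0, 1), (0, -1)} ↔
      ((1 : ℝ), (1 : ℝ)) ∈ _root_.polar2 D := by
  set V : Set (ℝ × ℝ) := {((1 : ℝ), (0 : ℝ)), (-1, 0), (0, 1), (0, -1)} with hV
  constructor
  · intro e
    have hconv : Convex ℝ {q : ℝ × ℝ | q.1 + q.2 ≤ 1} :=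
      convex_halfSpace_le ⟨fun p q => by simp; ring, fun c p => by simp; ring⟩ 1
    have hsub : convexHull ℝ V ⊆ {q : ℝ × ℝ | q.1 + q.2 ≤ 1} :=
      convexHull_min (by rintro q (rfl | rfl | rfl | rfl) <;> norm_num) hconv
    intro q hq
    simpa using hsub (e ▸ hq)
  · intro hm
    apply Subset.antisymm
    · rintro ⟨x, y⟩ hp
      have hxy := hm _ (h.abs_mem_iff.2 hp)
      simp only [one_mul] at hxy
      have hmem : ∀ q ∈ V, q ∈ convexHull ℝ V := fun q hq => subset_convexHull ℝ V hq
      have hC := convex_convexHull ℝ V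
      have h0 : (0 : ℝ × ℝ) ∈ convexHull ℝ V := by
        have := hC (hmem (1, 0) (by simp [hV])) (hmem (-1, 0) (by simp [hV]))
          (by norm_num : (0 : ℝ) ≤ 1 / 2) (by norm_num : (0 : ℝ) ≤ 1 / 2) (by norm_num)
        convert this using 1
        ext <;> norm_num
      obtain ⟨p, hp, hpx⟩ : ∃ p ∈ V, |x| • p = (x, 0) := by
        rcases abs_choice x with e | e
        · exact ⟨(1, 0), by simp [hV], by ext <;> simp [e]⟩
        · exact ⟨(-1, 0), by simp [hV], by ext <;> simp [e]⟩
      obtain ⟨q, hq, hqy⟩ : ∃ q ∈ V, |y| • q = (0, y) := by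
        rcases abs_choice y with e | e
        · exact ⟨(0, 1), by simp [hV], by ext <;> simp [e]⟩
        · exact ⟨(0, -1), by simp [hV], by ext <;> simp [e]⟩
      have := hC.sum_mem (t := Finset.univ) (w := ![|x|, |y|, 1 - |x| - |y|])
        (z := ![p, q, 0]) (by
          intro i _
          fin_cases i
          · simp
          · simp
          · simp; linarith) (by simp [Fin.sum_univ_three]) (by
          intro i _
          fin_cases i
          · exact hmem p hp
          · exact hmem q hq
          · exact h0)
      simpa [Fin.sum_univ_three, hpx, hqy] using this
    · refine convexHull_min ?_ h.convex
      rintro q (rfl | rfl | rfl | rfl)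
      · exact h.right_mem
      · exact h.left_mem
      · exact h.top_mem
      · exact h.mk_mem_of_abs_le h.top_mem (by simp) (by simp)

theorem profileSqIntegral_mul_eq_of_mem (h : IsUnconditionalBody D)
    (hm : ((1 : ℝ), (1 : ℝ)) ∈ D) :
    profileSqIntegral D * profileSqIntegral (_root_.polar2 D) = 1 / 3 := by
  have h1 : profileSqIntegral D = ∫ _ in (0 : ℝ)..1, (1 : ℝ) := by
    refine intervalIntegral.integral_congr fun x hx => ?_
    rw [uIcc_of_le zero_le_one] at hx
    have : profile D x = 1 := (h.profile_le_one hx).antisymm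
      (h.le_profile (h.mk_mem_of_abs_le hm (by rw [abs_of_nonneg hx.1]; exact hx.2) (by simp)))
    simp [this]
  have h2 : profileSqIntegral (_root_.polar2 D) = ∫ x in (0 : ℝ)..1, (1 - x) ^ 2 := by
    refine intervalIntegral.integral_congr fun x hx => ?_
    rw [uIcc_of_le zero_le_one] at hx
    have h3 := h.polar2.profile_mem hx _ hm
    have h4 := h.polar2.one_sub_le_profile hx
    have : profile (_root_.polar2 D) x = 1 - x := by
      simp only at h3
      linarith
    simp only [this]
  rw [h1, h2, intervalIntegral.integral_comp_sub_left (fun x => x ^ 2) 1, integral_pow]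
  norm_num

theorem profileSqIntegral_mul_eq_iff (h : IsUnconditionalBody D) :
    profileSqIntegral D * profileSqIntegral (_root_.polar2 D) = 1 / 3 ↔
      ((1 : ℝ), (1 : ℝ)) ∈ D ∨ ((1 : ℝ), (1 : ℝ)) ∈ _root_.polar2 D := by
  constructor
  · intro heq
    set I := profileIntegral D with hI
    set J := profileIntegral (_root_.polar2 D) with hJ
    have hI0 : 1 / 2 ≤ I := h.half_le_profileIntegral
    have hIJ : 2 * (I * J) = 1 := le_antisymm
      (by linarith [h.one_add_le_nine_mul_profileSqIntegral_mul])
      h.one_le_two_mul_profileIntegral_mul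
    have diag : ∀ {E : Set (ℝ × ℝ)}, IsUnconditionalBody E → ∀ {j : ℝ}, 0 ≤ j →
        2 * (profileIntegral E * j) = 1 → (j, j) ∈ _root_.polar2 E := by
      intro E hE j hj he
      refine hE.mem_polar2_of_nonneg hj hj fun a b ha hp => ?_
      have := mul_le_mul_of_nonneg_left (hE.add_le_two_mul_profileIntegral ha hp) hj
      linarith
    have hJ0 : 1 / 2 ≤ J := h.polar2.half_le_profileIntegral
    have hJm : (J, J) ∈ _root_.polar2 D := diag h (by linarith) hIJ
    have hIm : (I, I) ∈ D := by
      have := diag h.polar2 (j := I) (by linarith) (by rw [mul_comm J I]; exact hIJ)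
      rwa [h.polar2_polar2] at this
    have hA := h.three_mul_profileSqIntegral_le hIm
    have hA' := h.polar2.three_mul_profileSqIntegral_le hJm
    rw [← hI] at hA
    rw [← hJ] at hA'
    have h1 := mul_le_mul hA hA' (by linarith [h.polar2.third_le_profileSqIntegral])
      (by positivity)
    have h2 : 3 / 2 ≤ I + J := by nlinarith
    have hI1 : I ≤ 1 := h.profileIntegral_le_one
    have h3 : 0 ≤ (2 * I - 1) * (I - 1) := by nlinarith
    rcases hI1.eq_or_lt with e | e
    · left
      rwa [e] at hIm
    · right
      have e2 : I = 1 / 2 := by nlinarith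
      have e3 : J = 1 := by rw [e2] at hIJ; linarith
      rwa [e3] at hJm
  · rintro (hm | hm)
    · exact h.profileSqIntegral_mul_eq_of_mem hm
    · have := h.polar2.profileSqIntegral_mul_eq_of_mem hm
      rwa [h.polar2_polar2, mul_comm] at this

end IsUnconditionalBody

/-- Lemma 3.6 of the paper: for a 1-unconditional convex polygon
`P ⊆ [-1,1]²` containing `B = (0,1)` and `D = (-1,0)`, the body of revolution
generated by `P` has Mahler volume at least `4π²/3`, with equality iff `P`
is the square `[-1,1]²` (cylinder) or the diamond
`conv{(1,0),(-1,0),(0,1),(0,-1)}` (bicone). -/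
theorem mahler_unconditional_polygon (P : Set (ℝ × ℝ))
    (hpoly : ∃ S : Finset (ℝ × ℝ), P = convexHull ℝ (S : Set (ℝ × ℝ)))
    (hsub : P ⊆ {p : ℝ × ℝ | |p.1| ≤ 1 ∧ |p.2| ≤ 1})
    (huncond : ∀ p ∈ P, ∀ ε δ : ℝ, (ε = 1 ∨ ε = -1) → (δ = 1 ∨ δ = -1) →
      (ε * p.1, δ * p.2) ∈ P)
    (hB : ((0 : ℝ), (1 : ℝ)) ∈ P) (hD : ((-1 : ℝ), (0 : ℝ)) ∈ P) :
    ENNReal.ofReal (4 * Real.pi ^ 2 / 3) ≤ mahler3 (revolution P) ∧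
    (mahler3 (revolution P) = ENNReal.ofReal (4 * Real.pi ^ 2 / 3) ↔
      P = {p : ℝ × ℝ | |p.1| ≤ 1 ∧ |p.2| ≤ 1} ∨
      P = convexHull ℝ {((1 : ℝ), (0 : ℝ)), (-1, 0), (0, 1), (0, -1)}) := by
  have h : IsUnconditionalBody P := by
    obtain ⟨S, rfl⟩ := hpoly
    exact ⟨(S.finite_toSet.isCompact_convexHull ℝ).isClosed, convex_convexHull ℝ _, hsub,
      huncond, hB, hD⟩
  have h3 := h.third_le_profileSqIntegral_mul
  have hπ : 0 < 4 * π ^ 2 := by positivity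
  have e : 4 * π ^ 2 / 3 = 4 * π ^ 2 * (1 / 3) := by ring
  rw [h.mahler3_revolution, h.eq_square_iff, h.eq_diamond_iff, ← h.profileSqIntegral_mul_eq_iff, e]
  refine ⟨ENNReal.ofReal_le_ofReal (mul_le_mul_of_nonneg_left h3 hπ.le), ?_⟩
  rw [ENNReal.ofReal_eq_ofReal_iff (by positivity) (by positivity)]
  exact ⟨fun he => mul_left_cancel₀ hπ.ne' he, fun he => by rw [he]⟩
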